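/- Let S be a Lalley–Gatzouras carpet. Then the Assouad dimension of S is at most β_x + β_y. -/

import Mathlib

open Set Metric Filter

/-- The Assouad dimension of a set `E` in a metric space: the infimum of all `α ≥ 0`
for which there is `C > 0` such that for every `x ∈ E` and all radii `0 < r ≤ R`,
the set `E ∩ B(x, R)` can be covered by at most `C · (R / r) ^ α` balls of radius `r`. -/
noncomputable def assouadDim {X : Type*} [PseudoMetricSpace X] (E : Set X) : ℝ :=
  sInf { α : ℝ | 0 ≤ α ∧ ∃ C : ℝ, 0 < C ∧ ∀ x ∈ E, ∀ r R : ℝ, 0 < r → r ≤ R →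
    ∃ F : Finset X, (F.card : ℝ) ≤ C * (R / r) ^ α ∧
      E ∩ Metric.ball x R ⊆ ⋃ y ∈ F, Metric.ball y r }

/-- The defining data of a Lalley–Gatzouras carpet: `m ≥ 2` rows, the `i`-th row
(for `0 ≤ i < m`) containing `n i ≥ 1` affine maps `A_{ij}(x,y) = (a i j • x + c i j, b i • y + d i)`
(for `0 ≤ j < n i`), with at least one row containing at least two maps, each map contracting
strictly more horizontally than vertically, the rows stacked disjointly in order inside `[0,1]`
vertically, and the maps of each row placed disjointly in order inside `[0,1]` horizontally. -/
structure LGData where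
  m : ℕ
  n : ℕ → ℕ
  a : ℕ → ℕ → ℝ
  b : ℕ → ℝ
  c : ℕ → ℕ → ℝ
  d : ℕ → ℝ
  hm : 2 ≤ m
  hn_one : ∀ i, i < m → 1 ≤ n i
  hn_two : ∃ i, i < m ∧ 2 ≤ n i
  ha_pos : ∀ i, i < m → ∀ j, j < n i → 0 < a i j
  ha_lt_b : ∀ i, i < m → ∀ j, j < n i → a i j < b i
  hb_lt_one : ∀ i, i < m → b i < 1
  hd_nonneg : 0 ≤ d 0
  hd_gap : ∀ i, i + 1 < m → d i + b i ≤ d (i + 1)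
  hd_top : d (m - 1) + b (m - 1) ≤ 1
  hc_nonneg : ∀ i, i < m → 0 ≤ c i 0
  hc_gap : ∀ i, i < m → ∀ j, j + 1 < n i → c i j + a i j ≤ c i (j + 1)
  hc_top : ∀ i, i < m → c i (n i - 1) + a i (n i - 1) ≤ 1

/-- The affine map `A_{ij}(x, y) = (a_{ij} x + c_{ij}, b_i y + d_i)`. -/
def lgMap (D : LGData) (ij : ℕ × ℕ) (p : ℝ × ℝ) : ℝ × ℝ :=
  (D.a ij.1 ij.2 * p.1 + D.c ij.1 ij.2, D.b ij.1 * p.2 + D.d ij.1)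

/-- The composition `A_{ω_1} ∘ ⋯ ∘ A_{ω_k}` along a word `ω`. -/
def lgWordMap (D : LGData) : List (ℕ × ℕ) → ℝ × ℝ → ℝ × ℝ
  | [] => id
  | ij :: w => lgMap D ij ∘ lgWordMap D w

/-- The plane `ℝ²` with the Euclidean metric, identifying a pair with a Euclidean point. -/
noncomputable def toE (p : ℝ × ℝ) : EuclideanSpace ℝ (Fin 2) :=
  (WithLp.equiv 2 (Fin 2 → ℝ)).symm ![p.1, p.2]

/-- The Lalley–Gatzouras carpet: the limit set
`S = ⋂_{k ≥ 1} ⋃_{ω ∈ 𝒥^k} (A_{ω_1} ∘ ⋯ ∘ A_{ω_k})([0,1]²)`, as a subset of the Euclidean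
plane. -/
def lgCarpet (D : LGData) : Set (EuclideanSpace ℝ (Fin 2)) :=
  ⋂ k ∈ {k : ℕ | 1 ≤ k},
    ⋃ w ∈ {w : List (ℕ × ℕ) | w.length = k ∧ ∀ ij ∈ w, ij.1 < D.m ∧ ij.2 < D.n ij.1},
      (fun p : ℝ × ℝ => toE (lgWordMap D w p)) '' (Set.Icc (0 : ℝ) 1 ×ˢ Set.Icc (0 : ℝ) 1)

section MoranWords

variable {A : Type*}

/-- The composition along a word of the affine maps `t ↦ a p * t + c p` of the line. -/
def affineWord (a c : A → ℝ) : List A → ℝ → ℝ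
  | [] => id
  | p :: w => fun t => a p * affineWord a c w t + c p

/-- The contraction ratio of the affine map of a word. -/
def wordRatio (a : A → ℝ) (w : List A) : ℝ := (w.map a).prod

/-- A finite family of maps `t ↦ a p * t + c p` sending `[0,1]` to non-overlapping subintervals
of `[0,1]`, with ratios at least `α` whose `β`-th powers sum to at most `1`. The non-overlapping
condition is expressed through increments of monotone functions. -/
structure IsMoranLevel (a c : A → ℝ) (α β : ℝ) (G : Finset A) : Prop where
  le_ratio : ∀ p ∈ G, α ≤ a p
  offset_nonneg : ∀ p ∈ G, 0 ≤ c p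
  right_le_one : ∀ p ∈ G, a p + c p ≤ 1
  sum_rpow_le : ∑ p ∈ G, a p ^ β ≤ 1
  sum_increment_le : ∀ φ : ℝ → ℝ, Monotone φ →
    ∑ p ∈ G, (φ (a p + c p) - φ (c p)) ≤ φ 1 - φ 0

@[simp]
lemma wordRatio_nil (a : A → ℝ) : wordRatio a [] = 1 := rfl

@[simp]
lemma wordRatio_cons (a : A → ℝ) (p : A) (w : List A) :
    wordRatio a (p :: w) = a p * wordRatio a w := by
  simp [wordRatio]

lemma affineWord_eq (a c : A → ℝ) (w : List A) (t : ℝ) :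
    affineWord a c w t = wordRatio a w * t + affineWord a c w 0 := by
  induction w with
  | nil => simp [affineWord]
  | cons p w ih =>
    simp only [affineWord, wordRatio_cons]
    rw [ih]
    ring

lemma affineWord_append (a c : A → ℝ) (v w : List A) (t : ℝ) :
    affineWord a c (v ++ w) t = affineWord a c v (affineWord a c w t) := by
  induction v with
  | nil => simp [affineWord]
  | cons p v ih => simp [affineWord, ih]

lemma affineWord_mem_Icc {a c : A → ℝ} {w : List A}
    (hw : ∀ p ∈ w, 0 ≤ a p ∧ 0 ≤ c p ∧ a p + c p ≤ 1) {t : ℝ} (ht : t ∈ Icc (0 : ℝ) 1) :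
    affineWord a c w t ∈ Icc (0 : ℝ) 1 := by
  induction w with
  | nil => simpa [affineWord] using ht
  | cons p w ih =>
    obtain ⟨h0, h1⟩ := ih fun q hq => hw q (List.mem_cons_of_mem _ hq)
    obtain ⟨ha, hc, hac⟩ := hw p List.mem_cons_self
    exact ⟨by simp only [affineWord]; positivity, by simp only [affineWord]; nlinarith⟩

lemma wordRatio_nonneg {a : A → ℝ} {w : List A} (hw : ∀ p ∈ w, 0 ≤ a p) :
    0 ≤ wordRatio a w :=
  List.prod_nonneg (by simpa using hw)

lemma IsMoranLevel.forall_mem_word {a c : A → ℝ} {α β : ℝ} (hα : 0 ≤ α) {L : List (Finset A)}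
    (hL : ∀ G ∈ L, IsMoranLevel a c α β G) {w : List A} (hw : List.Forall₂ (· ∈ ·) w L) :
    ∀ p ∈ w, 0 ≤ a p ∧ 0 ≤ c p ∧ a p + c p ≤ 1 := by
  induction hw with
  | nil => simp
  | @cons p G w L hp _ ih =>
    have hG := hL G List.mem_cons_self
    intro q hq
    rcases List.mem_cons.1 hq with rfl | hq
    · exact ⟨hα.trans (hG.le_ratio _ hp), hG.offset_nonneg _ hp, hG.right_le_one _ hp⟩
    · exact ih (fun G hG => hL G (List.mem_cons_of_mem _ hG)) q hq

/-- Families of words prefixing the tails, one for each first letter, assemble into a single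
family of words. -/
lemma exists_prefix_family_cons {a : A → ℝ} {G : Finset A} (ha : ∀ p ∈ G, 0 < a p)
    {P : List A → Prop} {Q : A → List A → Prop} {N : A → ℝ} {r : ℝ}
    (h : ∀ p ∈ G, ∃ W : Finset (List A), (W.card : ℝ) ≤ N p ∧
      (∀ v ∈ W, wordRatio a v ≤ r / a p) ∧ ∀ w, P w → Q p w → ∃ v ∈ W, v <+: w) :
    ∃ W : Finset (List A), (W.card : ℝ) ≤ ∑ p ∈ G, N p ∧ (∀ v ∈ W, wordRatio a v ≤ r) ∧
      ∀ p ∈ G, ∀ w, P w → Q p w → ∃ v ∈ W, v <+: p :: w := by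
  classical
  choose! V hcard hratio hcover using h
  refine ⟨G.biUnion fun p => (V p).image (p :: ·), ?_, ?_, ?_⟩
  · calc ((G.biUnion fun p => (V p).image (p :: ·)).card : ℝ)
        ≤ ∑ p ∈ G, (((V p).image (p :: ·)).card : ℝ) := mod_cast Finset.card_biUnion_le
      _ ≤ ∑ p ∈ G, N p := Finset.sum_le_sum fun p hp =>
          le_trans (mod_cast Finset.card_image_le) (hcard p hp)
  · intro v hv
    simp only [Finset.mem_biUnion, Finset.mem_image] at hv
    obtain ⟨p, hp, v, hv, rfl⟩ := hv
    have := hratio p hp v hv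
    rw [le_div_iff₀ (ha p hp)] at this
    rw [wordRatio_cons]
    linarith
  · intro p hp w hw hq
    obtain ⟨v, hv, hvw⟩ := hcover p hp w hw hq
    refine ⟨p :: v, ?_, by simpa using hvw⟩
    simp only [Finset.mem_biUnion, Finset.mem_image]
    exact ⟨p, hp, v, hv, rfl⟩

/-- The words of a Moran construction can be stopped when their ratio drops below `r`, using at
most `(α r) ^ (-β)` words. -/
lemma exists_prefix_family {a c : A → ℝ} {α β : ℝ} (hα : 0 < α) (hβ : 0 ≤ β)
    (L : List (Finset A)) (hL : ∀ G ∈ L, IsMoranLevel a c α β G) {r : ℝ} (hr : 0 < r)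
    (hr' : α * r ≤ 1) (hfull : ∀ w, List.Forall₂ (· ∈ ·) w L → wordRatio a w ≤ r) :
    ∃ W : Finset (List A), (W.card : ℝ) ≤ (α * r) ^ (-β) ∧ (∀ v ∈ W, wordRatio a v ≤ r) ∧
      ∀ w, List.Forall₂ (· ∈ ·) w L → ∃ v ∈ W, v <+: w := by
  have hone : 1 ≤ (α * r) ^ (-β) :=
    Real.one_le_rpow_of_pos_of_le_one_of_nonpos (by positivity) hr' (by linarith)
  induction L generalizing r with
  | nil =>
    have := hfull [] List.Forall₂.nil
    exact ⟨{[]}, by simpa using hone, by simpa using this, fun w _ => ⟨[], by simp⟩⟩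
  | cons G L ih =>
    rcases le_or_gt 1 r with h1 | h1
    · exact ⟨{[]}, by simpa using hone, by simpa using h1, fun w _ => ⟨[], by simp⟩⟩
    have hG := hL G List.mem_cons_self
    have ha : ∀ p ∈ G, 0 < a p := fun p hp => hα.trans_le (hG.le_ratio p hp)
    obtain ⟨W, hcard, hratio, hcover⟩ := exists_prefix_family_cons (a := a) (G := G) ha
      (P := fun w => List.Forall₂ (· ∈ ·) w L) (Q := fun _ _ => True)
      (N := fun p => (α * r) ^ (-β) * a p ^ β) (r := r) (by
        intro p hp
        have hap := ha p hp
        have hr₁ : α * (r / a p) ≤ 1 := by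
          rw [mul_div_assoc', div_le_one hap]
          nlinarith [hG.le_ratio p hp]
        obtain ⟨W, hcard, hratio, hcover⟩ := ih (fun G hG => hL G (List.mem_cons_of_mem _ hG))
          (r := r / a p) (by positivity) hr₁
          (fun w hw => by
            have := hfull (p :: w) (List.Forall₂.cons hp hw)
            rw [wordRatio_cons] at this
            rw [le_div_iff₀ hap]
            linarith)
          (Real.one_le_rpow_of_pos_of_le_one_of_nonpos (by positivity) hr₁ (by linarith))
        refine ⟨W, hcard.trans_eq ?_, hratio, fun w hw _ => hcover w hw⟩
        rw [mul_div_assoc', Real.div_rpow (by positivity) hap.le, Real.rpow_neg hap.le,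
          div_inv_eq_mul])
    refine ⟨W, ?_, hratio, ?_⟩
    · rw [← Finset.mul_sum] at hcard
      exact hcard.trans (mul_le_of_le_one_right (by positivity) hG.sum_rpow_le)
    · intro w hw
      obtain ⟨p, w, hp, hw', rfl⟩ := List.forall₂_cons_right_iff.1 hw
      exact hcover p hp w hw' trivial

lemma exists_prefix_family_inter_of_one_le {a c : A → ℝ} {α β : ℝ} (hα : 0 < α) (hβ : 0 ≤ β)
    (L : List (Finset A)) (hL : ∀ G ∈ L, IsMoranLevel a c α β G) {r R : ℝ} (hr : 0 < r)
    (hrR : r ≤ R) (hR : α * R ≤ 1) (hR₁ : 1 ≤ R) {J : Set ℝ} {φ : ℝ → ℝ} (hφ : Monotone φ)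
    (hJ : ∀ p q z, p ≤ z → z ≤ q → q - p ≤ R → z ∈ J → q - p ≤ φ q - φ p)
    (hfull : ∀ w, List.Forall₂ (· ∈ ·) w L → wordRatio a w ≤ r) :
    ∃ W : Finset (List A),
      (W.card : ℝ) ≤ α ^ (-β) * α⁻¹ * (R / r) ^ β / R * (φ 1 - φ 0) ∧
      (∀ v ∈ W, wordRatio a v ≤ r) ∧
      ∀ w, List.Forall₂ (· ∈ ·) w L → ∀ t ∈ Icc (0 : ℝ) 1, affineWord a c w t ∈ J →
        ∃ v ∈ W, v <+: w := by
  have hR0 : 0 < R := hr.trans_le hrR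
  by_cases h : ∃ w t, List.Forall₂ (· ∈ ·) w L ∧ t ∈ Icc (0 : ℝ) 1 ∧ affineWord a c w t ∈ J
  · obtain ⟨w, t, hw, ht, hwt⟩ := h
    obtain ⟨h0, h1⟩ := affineWord_mem_Icc (IsMoranLevel.forall_mem_word hα.le hL hw) ht
    have hinc := hJ 0 1 _ h0 h1 (by linarith) hwt
    obtain ⟨W, hcard, hratio, hcover⟩ :=
      exists_prefix_family hα hβ L hL hr (by nlinarith) hfull
    refine ⟨W, hcard.trans ?_, hratio, fun w hw _ _ _ => hcover w hw⟩
    have hscale : r ^ (-β) ≤ (R / r) ^ β := by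
      rw [Real.rpow_neg hr.le, ← Real.inv_rpow hr.le]
      apply Real.rpow_le_rpow (by positivity) _ hβ
      rw [inv_eq_one_div]
      gcongr
    have hfactor : 1 ≤ α⁻¹ / R * (φ 1 - φ 0) := by
      have : 1 ≤ α⁻¹ / R := by
        rw [le_div_iff₀ hR0, one_mul, le_inv_comm₀ hR0 hα, ← one_div, le_div_iff₀ hR0]
        exact hR
      nlinarith
    rw [Real.mul_rpow hα.le hr.le]
    calc α ^ (-β) * r ^ (-β) ≤ α ^ (-β) * (R / r) ^ β := by gcongr
      _ ≤ α ^ (-β) * (R / r) ^ β * (α⁻¹ / R * (φ 1 - φ 0)) :=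
          le_mul_of_one_le_right (by positivity) hfactor
      _ = _ := by ring
  · push Not at h
    refine ⟨∅, ?_, by simp, fun w hw t ht hwt => absurd hwt (h w t hw ht)⟩
    have : 0 ≤ φ 1 - φ 0 := sub_nonneg.2 (hφ zero_le_one)
    simp only [Finset.card_empty, Nat.cast_zero]
    positivity

/-- A localized version of `exists_prefix_family`: only words reaching the set `J` are covered,
and the number of words at scale `R` is controlled by the increment of a monotone function `φ`
that expands the intervals of length at most `R` meeting `J`. -/
lemma exists_prefix_family_inter {a c : A → ℝ} {α β : ℝ} (hα : 0 < α) (hβ : 0 ≤ β)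
    (L : List (Finset A)) (hL : ∀ G ∈ L, IsMoranLevel a c α β G) {r R : ℝ} (hr : 0 < r)
    (hrR : r ≤ R) (hR : α * R ≤ 1) {J : Set ℝ} {φ : ℝ → ℝ} (hφ : Monotone φ)
    (hJ : ∀ p q z, p ≤ z → z ≤ q → q - p ≤ R → z ∈ J → q - p ≤ φ q - φ p)
    (hfull : ∀ w, List.Forall₂ (· ∈ ·) w L → wordRatio a w ≤ r) :
    ∃ W : Finset (List A),
      (W.card : ℝ) ≤ α ^ (-β) * α⁻¹ * (R / r) ^ β / R * (φ 1 - φ 0) ∧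
      (∀ v ∈ W, wordRatio a v ≤ r) ∧
      ∀ w, List.Forall₂ (· ∈ ·) w L → ∀ t ∈ Icc (0 : ℝ) 1, affineWord a c w t ∈ J →
        ∃ v ∈ W, v <+: w := by
  induction L generalizing r R J φ with
  | nil =>
    exact exists_prefix_family_inter_of_one_le hα hβ [] hL hr hrR hR
      (le_trans (by simpa using hfull [] List.Forall₂.nil) hrR) hφ hJ hfull
  | cons G L ih =>
    rcases le_or_gt 1 R with h1 | h1
    · exact exists_prefix_family_inter_of_one_le hα hβ _ hL hr hrR hR h1 hφ hJ hfull
    have hR0 : 0 < R := hr.trans_le hrR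
    have hG := hL G List.mem_cons_self
    have ha : ∀ p ∈ G, 0 < a p := fun p hp => hα.trans_le (hG.le_ratio p hp)
    obtain ⟨W, hcard, hratio, hcover⟩ := exists_prefix_family_cons (a := a) (G := G) ha
      (P := fun w => List.Forall₂ (· ∈ ·) w L)
      (Q := fun p w => ∃ t ∈ Icc (0 : ℝ) 1, affineWord a c (p :: w) t ∈ J)
      (N := fun p => α ^ (-β) * α⁻¹ * (R / r) ^ β / R * (φ (a p + c p) - φ (c p))) (r := r) (by
        intro p hp
        have hap := ha p hp
        obtain ⟨W, hcard, hratio, hcover⟩ := ih (fun G hG => hL G (List.mem_cons_of_mem _ hG))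
          (r := r / a p) (R := R / a p) (by positivity) (by gcongr)
          (by rw [mul_div_assoc', div_le_one hap]; nlinarith [hG.le_ratio p hp])
          (J := {t | a p * t + c p ∈ J}) (φ := fun t => φ (a p * t + c p) / a p)
          (fun s t hst => by
            have : φ (a p * s + c p) ≤ φ (a p * t + c p) := hφ (by gcongr)
            simp only
            gcongr)
          (fun s t z hs ht hst hz => by
            rw [le_div_iff₀ hap] at hst
            have := hJ (a p * s + c p) (a p * t + c p) (a p * z + c p) (by gcongr) (by gcongr)
              (by linarith) hz
            rw [← sub_div, le_div_iff₀ hap]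
            linarith)
          (fun w hw => by
            have := hfull (p :: w) (List.Forall₂.cons hp hw)
            rw [wordRatio_cons] at this
            rw [le_div_iff₀ hap]
            linarith)
        refine ⟨W, hcard.trans_eq ?_, hratio, fun w hw ⟨t, ht, hwt⟩ => hcover w hw t ht hwt⟩
        rw [div_div_div_cancel_right₀ hap.ne']
        simp only [mul_one, mul_zero, zero_add]
        field_simp)
    refine ⟨W, ?_, hratio, ?_⟩
    · rw [← Finset.mul_sum] at hcard
      exact hcard.trans (mul_le_mul_of_nonneg_left (hG.sum_increment_le φ hφ) (by positivity))
    · intro w hw t ht hwt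
      obtain ⟨p, w, hp, hw', rfl⟩ := List.forall₂_cons_right_iff.1 hw
      exact hcover p hp w hw' ⟨t, ht, hwt⟩

/-- The words of a Moran construction reaching a ball of radius `R` can be stopped when their
ratio drops below `r`, using at most a constant times `(R / r) ^ β` words. -/
lemma exists_prefix_family_ball {a c : A → ℝ} {α β : ℝ} (hα : 0 < α) (hα₁ : α ≤ 1) (hβ : 0 ≤ β)
    (L : List (Finset A)) (hL : ∀ G ∈ L, IsMoranLevel a c α β G) {r R : ℝ} (hr : 0 < r)
    (hrR : r ≤ R) (x : ℝ) (hfull : ∀ w, List.Forall₂ (· ∈ ·) w L → wordRatio a w ≤ r) :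
    ∃ W : Finset (List A),
      (W.card : ℝ) ≤ 4 * (α ^ (-β) * α⁻¹) * (R / r) ^ β ∧ (∀ v ∈ W, wordRatio a v ≤ r) ∧
      ∀ w, List.Forall₂ (· ∈ ·) w L → ∀ t ∈ Icc (0 : ℝ) 1, |affineWord a c w t - x| ≤ R →
        ∃ v ∈ W, v <+: w := by
  have hR0 : 0 < R := hr.trans_le hrR
  have hαβ : 1 ≤ α ^ (-β) :=
    Real.one_le_rpow_of_pos_of_le_one_of_nonpos hα hα₁ (by linarith)
  have hαinv : 1 ≤ α⁻¹ := (one_le_inv₀ hα).2 hα₁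
  have hratio1 : 1 ≤ (R / r) ^ β := Real.one_le_rpow ((one_le_div hr).2 hrR) hβ
  rcases le_or_gt 1 r with h1 | h1
  · refine ⟨{[]}, ?_, by simpa using h1, fun w _ _ _ _ => ⟨[], by simp⟩⟩
    have := one_le_mul_of_one_le_of_one_le (one_le_mul_of_one_le_of_one_le hαβ hαinv) hratio1
    simp only [Finset.card_singleton, Nat.cast_one]
    linarith
  rcases le_or_gt 1 R with hR | hR
  · obtain ⟨W, hcard, hratio, hcover⟩ :=
      exists_prefix_family hα hβ L hL hr (by nlinarith) hfull
    refine ⟨W, hcard.trans ?_, hratio, fun w hw _ _ _ => hcover w hw⟩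
    have hscale : r ^ (-β) ≤ (R / r) ^ β := by
      rw [Real.rpow_neg hr.le, ← Real.inv_rpow hr.le]
      apply Real.rpow_le_rpow (by positivity) _ hβ
      rw [inv_eq_one_div]
      gcongr
    rw [Real.mul_rpow hα.le hr.le]
    gcongr
    have : α ^ (-β) ≤ α ^ (-β) * α⁻¹ := le_mul_of_one_le_right (by positivity) hαinv
    linarith
  · let φ : ℝ → ℝ := fun t => max (x - 2 * R) (min t (x + 2 * R))
    have hφ : Monotone φ := fun s t hst => max_le_max le_rfl (min_le_min hst le_rfl)
    obtain ⟨W, hcard, hratio, hcover⟩ := exists_prefix_family_inter hα hβ L hL hr hrR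
      (by nlinarith) (J := {t | |t - x| ≤ R}) hφ
      (by
        intro p q z hp hq hpq hz
        obtain ⟨hz₁, hz₂⟩ := abs_le.1 (mem_ofPred.1 hz)
        have h₁ : φ p = p := by
          simp only [φ]
          rw [min_eq_left (by linarith), max_eq_right (by linarith)]
        have h₂ : φ q = q := by
          simp only [φ]
          rw [min_eq_left (by linarith), max_eq_right (by linarith)]
        rw [h₁, h₂])
      hfull
    refine ⟨W, hcard.trans ?_, hratio, hcover⟩
    have hinc : φ 1 - φ 0 ≤ 4 * R := by
      have h₁ : φ 1 ≤ x + 2 * R := max_le (by linarith) (min_le_right _ _)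
      have h₂ : x - 2 * R ≤ φ 0 := le_max_left _ _
      linarith
    calc _ ≤ α ^ (-β) * α⁻¹ * (R / r) ^ β / R * (4 * R) := by gcongr
      _ = _ := by field_simp

end MoranWords

/-- Intervals placed in increasing order in `[0,1]` form a level of a Moran construction. -/
lemma isMoranLevel_range {n : ℕ} (hn : 1 ≤ n) {a c : ℕ → ℝ} {α β : ℝ} (hα : 0 < α)
    (ha : ∀ j < n, α ≤ a j) (hc : 0 ≤ c 0) (hgap : ∀ j, j + 1 < n → c j + a j ≤ c (j + 1))
    (htop : c (n - 1) + a (n - 1) ≤ 1) (hsum : ∑ j ∈ Finset.range n, a j ^ β ≤ 1) :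
    IsMoranLevel a c α β (Finset.range n) where
  le_ratio j hj := ha j (Finset.mem_range.1 hj)
  offset_nonneg j hj := by
    rw [Finset.mem_range] at hj
    induction j with
    | zero => exact hc
    | succ j ih => linarith [ih (by omega), hgap j hj, ha j (by omega)]
  right_le_one j hj := by
    have key : ∀ k < n, ∀ j ≤ k, c j + a j ≤ c k + a k := by
      intro k
      induction k with
      | zero => intro _ j hj; simp [Nat.le_zero.1 hj]
      | succ k ih =>
        intro hk j hj
        rcases Nat.lt_or_ge k j with h | h
        · rw [show j = k + 1 by omega]
        · linarith [ih (by omega) j h, hgap k hk, ha (k + 1) hk]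
    rw [Finset.mem_range] at hj
    linarith [key (n - 1) (by omega) j (by omega)]
  sum_rpow_le := hsum
  sum_increment_le φ hφ := by
    have key : ∀ k < n, ∑ j ∈ Finset.range (k + 1), (φ (a j + c j) - φ (c j)) ≤
        φ (a k + c k) - φ 0 := by
      intro k hk
      induction k with
      | zero => simpa using sub_le_sub_left (hφ hc) (φ (a 0 + c 0))
      | succ k ih =>
        rw [Finset.sum_range_succ]
        have h₁ : φ (a k + c k) ≤ φ (c (k + 1)) := hφ (by linarith [hgap k hk])
        linarith [ih (by omega)]
    have h₁ := key (n - 1) (by omega)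
    rw [Nat.sub_add_cancel hn] at h₁
    have h₂ : φ (a (n - 1) + c (n - 1)) ≤ φ 1 := hφ (by linarith)
    linarith

/-- If `∑ a_j ≤ 1` and the equation `∑ a_j ^ s = 1` has no solution in `(β, 1]`, then
`∑ a_j ^ β ≤ 1`. -/
lemma sum_rpow_le_one_of_forall_le {ι : Type*} {s : Finset ι} {a : ι → ℝ}
    (ha : ∀ j ∈ s, 0 < a j) (hsum : ∑ j ∈ s, a j ≤ 1) {β : ℝ} (hβ : β ∈ Ioc (0 : ℝ) 1)
    (hmax : ∀ t ∈ Ioc (0 : ℝ) 1, ∑ j ∈ s, a j ^ t = 1 → t ≤ β) :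
    ∑ j ∈ s, a j ^ β ≤ 1 := by
  by_contra! h
  have hcont : ContinuousOn (fun t : ℝ => ∑ j ∈ s, a j ^ t) (Icc β 1) :=
    continuousOn_finsetSum _ fun j hj =>
      (Real.continuous_const_rpow (ha j hj).ne').continuousOn
  obtain ⟨t, ⟨ht₀, ht₁⟩, ht⟩ := intermediate_value_Icc' hβ.2 hcont
    (show (1 : ℝ) ∈ Icc _ _ from ⟨by simpa using hsum, h.le⟩)
  have htβ : t = β := le_antisymm (hmax t ⟨hβ.1.trans_le ht₀, ht₁⟩ ht) ht₀
  subst htβ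
  exact h.ne' ht

lemma toE_apply_zero (p : ℝ × ℝ) : toE p 0 = p.1 := by simp [toE]

lemma toE_apply_one (p : ℝ × ℝ) : toE p 1 = p.2 := by simp [toE]

lemma abs_apply_sub_le_dist (z x : EuclideanSpace ℝ (Fin 2)) (i : Fin 2) :
    |z i - x i| ≤ dist z x := by
  rw [dist_eq_norm]
  simpa using PiLp.norm_apply_le (z - x) i

lemma toE_dist_lt {p q : ℝ × ℝ} {r : ℝ} (hr : 0 < r) (h₁ : |p.1 - q.1| ≤ r / 2)
    (h₂ : |p.2 - q.2| ≤ r / 2) : dist (toE p) (toE q) < r := by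
  rw [EuclideanSpace.dist_eq, Real.sqrt_lt' hr, Fin.sum_univ_two]
  simp only [toE_apply_zero, toE_apply_one, Real.dist_eq]
  nlinarith [abs_nonneg (p.1 - q.1), abs_nonneg (p.2 - q.2)]

namespace LGData

variable (D : LGData)

lemma b_pos {i : ℕ} (hi : i < D.m) : 0 < D.b i :=
  (D.ha_pos i hi 0 (D.hn_one i hi)).trans (D.ha_lt_b i hi 0 (D.hn_one i hi))

lemma exists_ratio_lower_bound :
    ∃ α : ℝ, 0 < α ∧ α ≤ 1 ∧ ∀ i < D.m, ∀ j < D.n i, α ≤ D.a i j := by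
  classical
  let s := (Finset.range D.m).sigma fun i => Finset.range (D.n i)
  have hs : s.Nonempty :=
    ⟨⟨0, 0⟩, by simpa [s] using ⟨by have := D.hm; omega, D.hn_one 0 (by have := D.hm; omega)⟩⟩
  obtain ⟨p, hp, hmin⟩ := s.exists_min_image (fun p => D.a p.1 p.2) hs
  simp only [s, Finset.mem_sigma, Finset.mem_range] at hp
  refine ⟨D.a p.1 p.2, D.ha_pos _ hp.1 _ hp.2,
    ((D.ha_lt_b _ hp.1 _ hp.2).trans (D.hb_lt_one _ hp.1)).le, fun i hi j hj => ?_⟩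
  exact hmin ⟨i, j⟩ (by simp [s, hi, hj])

lemma exists_pow_bound {r : ℝ} (hr : 0 < r) :
    ∃ k, 1 ≤ k ∧ ∀ w : List ℕ, w.length = k → (∀ i ∈ w, i < D.m) → wordRatio D.b w ≤ r := by
  obtain ⟨i₀, hi₀, hmax⟩ := (Finset.range D.m).exists_max_image D.b
    ⟨0, by have := D.hm; simp; omega⟩
  rw [Finset.mem_range] at hi₀
  obtain ⟨k, hk⟩ := exists_pow_lt_of_lt_one hr (D.hb_lt_one i₀ hi₀)
  have hle : ∀ w : List ℕ, (∀ i ∈ w, i < D.m) → wordRatio D.b w ≤ D.b i₀ ^ w.length := by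
    intro w hw
    induction w with
    | nil => simp
    | cons i w ih =>
      rw [wordRatio_cons, List.length_cons, pow_succ']
      have hi := hw i List.mem_cons_self
      have hw' : ∀ i ∈ w, i < D.m := fun i h => hw i (List.mem_cons_of_mem _ h)
      exact mul_le_mul (hmax i (Finset.mem_range.2 hi)) (ih hw')
        (wordRatio_nonneg fun i h => (D.b_pos (hw' i h)).le) (D.b_pos hi₀).le
  refine ⟨k + 1, by omega, fun w hlen hw => (hle w hw).trans ?_⟩
  rw [hlen]
  exact (pow_le_pow_of_le_one (D.b_pos hi₀).le (D.hb_lt_one i₀ hi₀).le k.le_succ).trans hk.le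

/-- The letters of the `i`-th row. -/
def rowLetters (i : ℕ) : Finset (ℕ × ℕ) := {i} ×ˢ Finset.range (D.n i)

lemma mem_rowLetters {i : ℕ} {p : ℕ × ℕ} :
    p ∈ D.rowLetters i ↔ p.1 = i ∧ p.2 < D.n i := by
  simp only [rowLetters, Finset.mem_product, Finset.mem_singleton, Finset.mem_range]

lemma isMoranLevel_rows {α β : ℝ} (hα : 0 < α)
    (ha : ∀ i < D.m, ∀ j < D.n i, α ≤ D.a i j)
    (hsum : ∑ i ∈ Finset.range D.m, D.b i ^ β ≤ 1) :
    IsMoranLevel D.b D.d α β (Finset.range D.m) :=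
  isMoranLevel_range (by have := D.hm; omega) hα
    (fun i hi => (ha i hi 0 (D.hn_one i hi)).trans (D.ha_lt_b i hi 0 (D.hn_one i hi)).le)
    D.hd_nonneg D.hd_gap D.hd_top hsum

lemma isMoranLevel_row {α β : ℝ} (hα : 0 < α) {i : ℕ} (hi : i < D.m)
    (ha : ∀ j < D.n i, α ≤ D.a i j) (hsum : ∑ j ∈ Finset.range (D.n i), D.a i j ^ β ≤ 1) :
    IsMoranLevel (D.a i) (D.c i) α β (Finset.range (D.n i)) :=
  isMoranLevel_range (D.hn_one i hi) hα ha (D.hc_nonneg i hi) (D.hc_gap i hi) (D.hc_top i hi) hsum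

lemma isMoranLevel_rowLetters {α β : ℝ} (hα : 0 < α) {i : ℕ} (hi : i < D.m)
    (ha : ∀ j < D.n i, α ≤ D.a i j) (hsum : ∑ j ∈ Finset.range (D.n i), D.a i j ^ β ≤ 1) :
    IsMoranLevel (fun p : ℕ × ℕ => D.a p.1 p.2) (fun p => D.c p.1 p.2) α β (D.rowLetters i) := by
  have h := D.isMoranLevel_row hα hi ha hsum
  constructor
  · rintro ⟨i, j⟩ hp
    obtain ⟨rfl, hj⟩ := D.mem_rowLetters.1 hp
    exact h.le_ratio j (Finset.mem_range.2 hj)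
  · rintro ⟨i, j⟩ hp
    obtain ⟨rfl, hj⟩ := D.mem_rowLetters.1 hp
    exact h.offset_nonneg j (Finset.mem_range.2 hj)
  · rintro ⟨i, j⟩ hp
    obtain ⟨rfl, hj⟩ := D.mem_rowLetters.1 hp
    exact h.right_le_one j (Finset.mem_range.2 hj)
  · simpa [rowLetters, Finset.sum_product] using h.sum_rpow_le
  · intro φ hφ
    simpa only [rowLetters, Finset.sum_product, Finset.sum_singleton] using h.sum_increment_le φ hφ

lemma sum_row_rpow_le_one {βx : ℝ} (hβx : βx ∈ Ioc (0 : ℝ) 1)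
    (hmax : ∀ α ∈ Ioc (0 : ℝ) 1,
      (∃ i, i < D.m ∧ ∑ j ∈ Finset.range (D.n i), D.a i j ^ α = 1) → α ≤ βx)
    {i : ℕ} (hi : i < D.m) : ∑ j ∈ Finset.range (D.n i), D.a i j ^ βx ≤ 1 := by
  refine sum_rpow_le_one_of_forall_le (fun j hj => D.ha_pos i hi j (Finset.mem_range.1 hj)) ?_ hβx
    fun t ht h => hmax t ht ⟨i, hi, h⟩
  have key : ∀ k < D.n i, ∑ j ∈ Finset.range (k + 1), D.a i j ≤ D.c i k + D.a i k := by
    intro k hk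
    induction k with
    | zero => simpa using D.hc_nonneg i hi
    | succ k ih =>
      rw [Finset.sum_range_succ]
      linarith [ih (by omega), D.hc_gap i hi k hk]
  have hn := D.hn_one i hi
  have h := key (D.n i - 1) (by omega)
  rw [Nat.sub_add_cancel hn] at h
  exact h.trans (D.hc_top i hi)

lemma lgWordMap_eq (w : List (ℕ × ℕ)) (q : ℝ × ℝ) :
    lgWordMap D w q = (affineWord (fun p : ℕ × ℕ => D.a p.1 p.2) (fun p => D.c p.1 p.2) w q.1,
      affineWord D.b D.d (w.map Prod.fst) q.2) := by
  induction w with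
  | nil => rfl
  | cons p w ih => simp [lgWordMap, ih, lgMap, affineWord]

lemma forall₂_rowLetters {w : List (ℕ × ℕ)} (hw : ∀ p ∈ w, p.2 < D.n p.1) :
    List.Forall₂ (· ∈ ·) w ((w.map Prod.fst).map D.rowLetters) := by
  induction w with
  | nil => simp
  | cons p w ih =>
    simp only [List.map_cons, List.forall₂_cons]
    exact ⟨D.mem_rowLetters.2 ⟨rfl, hw p List.mem_cons_self⟩,
      ih fun q hq => hw q (List.mem_cons_of_mem _ hq)⟩

lemma wordRatio_le_of_forall₂ {u : List ℕ} (hu : ∀ i ∈ u, i < D.m) {w : List (ℕ × ℕ)}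
    (hw : List.Forall₂ (· ∈ ·) w (u.map D.rowLetters)) :
    0 ≤ wordRatio (fun p : ℕ × ℕ => D.a p.1 p.2) w ∧
      wordRatio (fun p : ℕ × ℕ => D.a p.1 p.2) w ≤ wordRatio D.b u := by
  induction u generalizing w with
  | nil => simp_all
  | cons i u ih =>
    rw [List.map_cons] at hw
    obtain ⟨⟨i', j⟩, w, hp, hw', rfl⟩ := List.forall₂_cons_right_iff.1 hw
    obtain ⟨h0, h1⟩ := ih (fun i hi => hu i (List.mem_cons_of_mem _ hi)) hw'
    obtain ⟨rfl, hj⟩ := D.mem_rowLetters.1 hp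
    have hi := hu _ List.mem_cons_self
    have ha := D.ha_pos _ hi _ hj
    have hb := D.ha_lt_b _ hi _ hj
    simp only [wordRatio_cons]
    exact ⟨by positivity, mul_le_mul hb.le h1 h0 (ha.trans hb).le⟩

/-- Every point of the carpet is represented by admissible words of every positive length. -/
lemma exists_word_of_mem_carpet {z : EuclideanSpace ℝ (Fin 2)} (hz : z ∈ lgCarpet D) {k : ℕ}
    (hk : 1 ≤ k) : ∃ w : List (ℕ × ℕ), w.length = k ∧ (∀ p ∈ w, p.1 < D.m ∧ p.2 < D.n p.1) ∧
      ∃ q : ℝ × ℝ, q.1 ∈ Icc (0 : ℝ) 1 ∧ q.2 ∈ Icc (0 : ℝ) 1 ∧ z = toE (lgWordMap D w q) := by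
  simp only [lgCarpet, mem_iInter] at hz
  have h := hz k hk
  simp only [mem_iUnion] at h
  obtain ⟨w, ⟨hlen, hw⟩, q, hq, rfl⟩ := h
  exact ⟨w, hlen, hw, q, hq.1, hq.2, rfl⟩

end LGData

lemma abs_affineWord_sub_le {A : Type*} {a c : A → ℝ} {v : List A} {r t : ℝ}
    (hv₀ : 0 ≤ wordRatio a v) (hv : wordRatio a v ≤ r) (ht : t ∈ Icc (0 : ℝ) 1) :
    |affineWord a c v t - affineWord a c v 0| ≤ r := by
  rw [affineWord_eq, add_sub_cancel_right, abs_of_nonneg (mul_nonneg hv₀ ht.1)]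
  exact (mul_le_of_le_one_right hv₀ ht.2).trans hv

lemma forall₂_mem_replicate {A : Type*} {G : Finset A} {k : ℕ} {w : List A} :
    List.Forall₂ (· ∈ ·) w (List.replicate k G) ↔ w.length = k ∧ ∀ p ∈ w, p ∈ G := by
  induction w generalizing k with
  | nil => cases k <;> simp [List.replicate_succ]
  | cons p w ih =>
    cases k with
    | zero => simp
    | succ k =>
      simp only [List.replicate_succ, List.forall₂_cons, ih, List.length_cons, List.mem_cons,
        forall_eq_or_imp, Nat.add_right_cancel_iff]
      tauto

/-- The Assouad dimension of a Lalley–Gatzouras carpet is at most `β_x + β_y`. -/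
theorem lg_assouadDim_le (D : LGData)

    (βx βy : ℝ)
    (hβy_mem : βy ∈ Set.Ioc (0 : ℝ) 1)
    (hβy_eq : ∑ i ∈ Finset.range D.m, D.b i ^ βy = 1)
    (hβx_mem : βx ∈ Set.Ioc (0 : ℝ) 1)
    (hβx_eq : ∃ i, i < D.m ∧ ∑ j ∈ Finset.range (D.n i), D.a i j ^ βx = 1)
    (hβx_max : ∀ α ∈ Set.Ioc (0 : ℝ) 1,
      (∃ i, i < D.m ∧ ∑ j ∈ Finset.range (D.n i), D.a i j ^ α = 1) → α ≤ βx) :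
    assouadDim (lgCarpet D) ≤ βx + βy := by
  classical
  obtain ⟨α, hα, hα₁, hαa⟩ := D.exists_ratio_lower_bound
  have hrows := D.isMoranLevel_rows hα hαa hβy_eq.le
  have hrow : ∀ i < D.m, IsMoranLevel (fun p : ℕ × ℕ => D.a p.1 p.2) (fun p => D.c p.1 p.2) α βx
      (D.rowLetters i) := fun i hi =>
    D.isMoranLevel_rowLetters hα hi (hαa i hi) (D.sum_row_rpow_le_one hβx_mem hβx_max hi)
  refine csInf_le ⟨0, fun s hs => hs.1⟩ ⟨by linarith [hβx_mem.1, hβy_mem.1],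
    (4 * (α ^ (-βy) * α⁻¹)) * (4 * (α ^ (-βx) * α⁻¹)) * 2 ^ (βx + βy), by positivity, ?_⟩
  intro x _ r R hr hrR
  have hR : 0 < R := hr.trans_le hrR
  have hr2 : 0 < r / 2 := by positivity
  have hr2R : r / 2 ≤ R := by linarith
  obtain ⟨k, hk, hkr⟩ := D.exists_pow_bound hr2
  obtain ⟨U, hUcard, hUratio, hUcover⟩ := exists_prefix_family_ball hα hα₁ hβy_mem.1.le
    (List.replicate k (Finset.range D.m))
    (fun G hG => by rw [List.eq_of_mem_replicate hG]; exact hrows) hr2 hr2R (x 1)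
    (fun w hw => by
      obtain ⟨hlen, hw⟩ := forall₂_mem_replicate.1 hw
      exact hkr w hlen fun i hi => Finset.mem_range.1 (hw i hi))
  have hV : ∀ u ∈ U, ∃ V : Finset (List (ℕ × ℕ)),
      (V.card : ℝ) ≤ 4 * (α ^ (-βx) * α⁻¹) * (R / (r / 2)) ^ βx ∧
      ((∀ i ∈ u, i < D.m) →
        (∀ v ∈ V, wordRatio (fun p : ℕ × ℕ => D.a p.1 p.2) v ≤ r / 2) ∧
        ∀ w, List.Forall₂ (· ∈ ·) w (u.map D.rowLetters) → ∀ t ∈ Icc (0 : ℝ) 1,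
          |affineWord (fun p : ℕ × ℕ => D.a p.1 p.2) (fun p => D.c p.1 p.2) w t - x 0| ≤ R →
          ∃ v ∈ V, v <+: w) := by
    intro u hu
    by_cases hum : ∀ i ∈ u, i < D.m
    · obtain ⟨V, hcard, hV⟩ := exists_prefix_family_ball hα hα₁ hβx_mem.1.le
        (u.map D.rowLetters)
        (fun G hG => by
          obtain ⟨i, hi, rfl⟩ := List.mem_map.1 hG
          exact hrow i (hum i hi)) hr2 hr2R (x 0)
        (fun w hw => (D.wordRatio_le_of_forall₂ hum hw).2.trans (hUratio u hu))
      exact ⟨V, hcard, fun _ => hV⟩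
    · exact ⟨∅, by simp only [Finset.card_empty, Nat.cast_zero]; positivity,
        fun h => absurd h hum⟩
  choose! V hVcard hV using hV
  refine ⟨U.biUnion fun u => (V u).image fun v =>
    toE (affineWord (fun p : ℕ × ℕ => D.a p.1 p.2) (fun p => D.c p.1 p.2) v 0,
      affineWord D.b D.d u 0), ?_, ?_⟩
  · calc _ ≤ ∑ u ∈ U, (((V u).image fun v =>
            toE (affineWord (fun p : ℕ × ℕ => D.a p.1 p.2) (fun p => D.c p.1 p.2) v 0,
              affineWord D.b D.d u 0)).card : ℝ) := mod_cast Finset.card_biUnion_le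
      _ ≤ ∑ u ∈ U, 4 * (α ^ (-βx) * α⁻¹) * (R / (r / 2)) ^ βx :=
          Finset.sum_le_sum fun u hu => le_trans (mod_cast Finset.card_image_le) (hVcard u hu)
      _ = U.card * (4 * (α ^ (-βx) * α⁻¹) * (R / (r / 2)) ^ βx) := by
          rw [Finset.sum_const, nsmul_eq_mul]
      _ ≤ 4 * (α ^ (-βy) * α⁻¹) * (R / (r / 2)) ^ βy *
            (4 * (α ^ (-βx) * α⁻¹) * (R / (r / 2)) ^ βx) := by gcongr
      _ = (4 * (α ^ (-βy) * α⁻¹)) * (4 * (α ^ (-βx) * α⁻¹)) * (R / (r / 2)) ^ (βx + βy) := by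
          rw [Real.rpow_add (by positivity)]
          ring
      _ = _ := by
          rw [show R / (r / 2) = 2 * (R / r) by field_simp,
            Real.mul_rpow (by positivity) (by positivity)]
          ring
  · rintro z ⟨hz, hzx⟩
    obtain ⟨w, hlen, hw, q, hq₁, hq₂, rfl⟩ := D.exists_word_of_mem_carpet hz hk
    have hx0 := (abs_apply_sub_le_dist _ x 0).trans (mem_ball.1 hzx).le
    have hx1 := (abs_apply_sub_le_dist _ x 1).trans (mem_ball.1 hzx).le
    rw [toE_apply_zero, D.lgWordMap_eq] at hx0
    rw [toE_apply_one, D.lgWordMap_eq] at hx1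
    obtain ⟨u, hu, s, hs⟩ := hUcover (w.map Prod.fst)
      (forall₂_mem_replicate.2 ⟨by simpa using hlen, by
        intro i hi
        obtain ⟨p, hp, rfl⟩ := List.mem_map.1 hi
        exact Finset.mem_range.2 (hw p hp).1⟩) q.2 hq₂ hx1
    obtain ⟨w₁, w₂, rfl, rfl, rfl⟩ := List.map_eq_append_iff.1 hs.symm
    have hunit : ∀ p ∈ w₁ ++ w₂, 0 ≤ D.a p.1 p.2 ∧ 0 ≤ D.c p.1 p.2 ∧
        D.a p.1 p.2 + D.c p.1 p.2 ≤ 1 := fun p hp => by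
      have hp' := D.mem_rowLetters.2 ⟨rfl, (hw p hp).2⟩
      have h := hrow p.1 (hw p hp).1
      exact ⟨hα.le.trans (h.le_ratio p hp'), h.offset_nonneg p hp', h.right_le_one p hp'⟩
    have hunit_rows : ∀ i ∈ (w₁ ++ w₂).map Prod.fst, 0 ≤ D.b i ∧ 0 ≤ D.d i ∧ D.b i + D.d i ≤ 1 := by
      intro i hi
      obtain ⟨p, hp, rfl⟩ := List.mem_map.1 hi
      have hp' := Finset.mem_range.2 (hw p hp).1
      exact ⟨(D.b_pos (hw p hp).1).le, hrows.offset_nonneg _ hp', hrows.right_le_one _ hp'⟩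
    have hum : ∀ i ∈ w₁.map Prod.fst, i < D.m := fun i hi => by
      obtain ⟨p, hp, rfl⟩ := List.mem_map.1 hi
      exact (hw p (List.mem_append_left _ hp)).1
    obtain ⟨hVratio, hVcover⟩ := hV _ hu hum
    obtain ⟨v, hv, s, rfl⟩ := hVcover w₁
      (D.forall₂_rowLetters fun p hp => (hw p (List.mem_append_left _ hp)).2)
      _ (affineWord_mem_Icc (fun p hp => hunit p (List.mem_append_right _ hp)) hq₁)
      (by rwa [← affineWord_append])
    simp only [Finset.mem_biUnion, Finset.mem_image, mem_iUnion]
    refine ⟨_, ⟨_, hu, v, hv, rfl⟩, toE_dist_lt hr ?_ ?_⟩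
    · rw [D.lgWordMap_eq, List.append_assoc, affineWord_append]
      refine abs_affineWord_sub_le (wordRatio_nonneg fun p hp => (hunit p (by simp [hp])).1)
        (hVratio v hv) (affineWord_mem_Icc (fun p hp => hunit p ?_) hq₁)
      simp only [List.mem_append] at hp ⊢
      tauto
    · rw [D.lgWordMap_eq, List.map_append]
      simp only [affineWord_append D.b]
      refine abs_affineWord_sub_le
        (wordRatio_nonneg fun i hi => (D.b_pos (hum i hi)).le)
        (hUratio _ hu) (affineWord_mem_Icc (fun i hi => hunit_rows i ?_) hq₂)
      rw [List.map_append]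
      exact List.mem_append_right _ hi
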